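/- arXiv:2509.26635 — 2 statements merged into one kernel-verified Lean document; each statement's English description precedes it below -/
import Mathlib

section
/- Let d ≥ 2, s ∈ {0,1}^d, and let f be a generator. Suppose there exist a continuous, strictly decreasing function φ : (0,1] → [0,∞) with φ(1) = 0 and a function ψ : [0,∞) → [0,1] with ψ(φ(t)) = t for all t ∈ (0,1], such that C_f^s(u) = ψ(Σ_{j=1}^d φ(u_j)) for all u ∈ (0,1]^d. Then C_f^s(u) = Π_{j=1}^d u_j for all u ∈ [0,1]^d; that is, the only Archimedean copula of this form is the independence copula. -/
open MeasureTheory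

/-- A generator: a probability density on `[0,1]`. -/
def IsGenerator (f : ℝ → ℝ) : Prop :=
  Measurable f ∧ (∀ x ∈ Set.Icc (0:ℝ) 1, 0 ≤ f x) ∧ ∫ x in Set.Icc (0:ℝ) 1, f x = 1

/-- Additive generators are logarithmic as soon as the induced binary operation is the product. -/
lemma generator_mul {φ ψ : ℝ → ℝ}
    (hφ_cont : ContinuousOn φ (Set.Ioc 0 1))
    (hφ_anti : StrictAntiOn φ (Set.Ioc 0 1))
    (hφ_nonneg : ∀ x ∈ Set.Ioc (0:ℝ) 1, 0 ≤ φ x)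
    (hψφ : ∀ x ∈ Set.Ioc (0:ℝ) 1, ψ (φ x) = x)
    (hφ_one : φ 1 = 0)
    (hmul : ∀ a ∈ Set.Ioc (0:ℝ) 1, ∀ b ∈ Set.Ioc (0:ℝ) 1, ψ (φ a + φ b) = a * b)
    {a b : ℝ} (ha : a ∈ Set.Ioc (0:ℝ) 1) (hb : b ∈ Set.Ioc (0:ℝ) 1) :
    φ (a * b) = φ a + φ b := by
  have key : ∀ a ∈ Set.Ioc (0:ℝ) 1, ∀ b ∈ Set.Ioc (0:ℝ) 1, ∀ t ∈ Set.Ioc (0:ℝ) 1,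
      φ t = φ a + φ b → t = a * b := by
    intro a ha b hb t ht h
    rw [← hψφ t ht, h, hmul a ha b hb]
  have hab : a * b / 2 ∈ Set.Ioc (0:ℝ) 1 := by
    have := mul_pos ha.1 hb.1
    have := mul_le_one₀ ha.2 hb.1.le hb.2
    constructor <;> linarith
  by_cases hle : φ a + φ b ≤ φ (a * b / 2)
  · obtain ⟨t, ht, hφt⟩ := intermediate_value_Icc' hab.2
      (hφ_cont.mono fun x hx => ⟨hab.1.trans_le hx.1, hx.2⟩)
      (show φ a + φ b ∈ Set.Icc (φ 1) (φ (a * b / 2)) from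
        ⟨by rw [hφ_one]; exact add_nonneg (hφ_nonneg a ha) (hφ_nonneg b hb), hle⟩)
    rw [← key a ha b hb t ⟨hab.1.trans_le ht.1, ht.2⟩ hφt, hφt]
  · exfalso
    push Not at hle
    have h1 : φ a ≤ φ (a * b / 2) := hφ_anti.antitoneOn hab ha (by nlinarith [ha.1, hb.2])
    obtain ⟨t, ht, hφt⟩ := intermediate_value_Icc' hb.2
      (hφ_cont.mono fun x hx => ⟨hb.1.trans_le hx.1, hx.2⟩)
      (show φ (a * b / 2) - φ a ∈ Set.Icc (φ 1) (φ b) from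
        ⟨by rw [hφ_one]; linarith, by linarith⟩)
    have h2 := key a ha t ⟨hb.1.trans_le ht.1, ht.2⟩ _ hab (by linarith)
    nlinarith [ha.1, hb.1, ht.1, mul_pos ha.1 hb.1, mul_le_mul_of_nonneg_left ht.1 ha.1.le]

/-- An Archimedean operation that is increasing in its first argument is, at each point, either
described by the additive generator or zero. -/
lemma archimedean_dichotomy {φ ψ : ℝ → ℝ} {B : ℝ → ℝ → ℝ}
    (hφ_cont : ContinuousOn φ (Set.Ioc 0 1))
    (hφ_anti : StrictAntiOn φ (Set.Ioc 0 1))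
    (hφ_nonneg : ∀ x ∈ Set.Ioc (0:ℝ) 1, 0 ≤ φ x)
    (hψφ : ∀ x ∈ Set.Ioc (0:ℝ) 1, ψ (φ x) = x)
    (hφ_one : φ 1 = 0)
    (hB : ∀ a ∈ Set.Ioc (0:ℝ) 1, ∀ b ∈ Set.Ioc (0:ℝ) 1, B a b = ψ (φ a + φ b))
    (hB_nonneg : ∀ a ∈ Set.Ioc (0:ℝ) 1, ∀ b ∈ Set.Ioc (0:ℝ) 1, 0 ≤ B a b)
    (hB_mono : ∀ a ∈ Set.Ioc (0:ℝ) 1, ∀ a' ∈ Set.Ioc (0:ℝ) 1, ∀ b ∈ Set.Ioc (0:ℝ) 1,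
      a ≤ a' → B a b ≤ B a' b)
    {u v : ℝ} (hu : u ∈ Set.Ioc (0:ℝ) 1) (hv : v ∈ Set.Ioc (0:ℝ) 1) :
    (B u v ∈ Set.Ioc (0:ℝ) 1 ∧ φ (B u v) = φ u + φ v) ∨
      (B u v = 0 ∧ ∀ t ∈ Set.Ioc (0:ℝ) 1, φ t < φ u + φ v) := by
  have hone : (1:ℝ) ∈ Set.Ioc (0:ℝ) 1 := Set.right_mem_Ioc.2 one_pos
  by_cases hr : ∃ t ∈ Set.Ioc (0:ℝ) 1, φ t = φ u + φ v
  · obtain ⟨t, ht, h⟩ := hr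
    have : B u v = t := by rw [hB u hu v hv, ← h, hψφ t ht]
    left
    rw [this]
    exact ⟨ht, h⟩
  · right
    have hlt : ∀ t ∈ Set.Ioc (0:ℝ) 1, φ t < φ u + φ v := by
      intro t ht
      by_contra! hle
      obtain ⟨x, hx, h⟩ := intermediate_value_Icc' ht.2
        (hφ_cont.mono fun x hx => ⟨ht.1.trans_le hx.1, hx.2⟩)
        (show φ u + φ v ∈ Set.Icc (φ 1) (φ t) from
          ⟨by rw [hφ_one]; exact add_nonneg (hφ_nonneg u hu) (hφ_nonneg v hv), hle⟩)
      exact hr ⟨x, ⟨ht.1.trans_le hx.1, hx.2⟩, h⟩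
    refine ⟨le_antisymm ?_ (hB_nonneg u hu v hv), hlt⟩
    have hsmall : ∀ ε ∈ Set.Ioc (0:ℝ) 1, B u v ≤ ε := by
      intro ε hε
      rcases le_or_gt v ε with h | h
      · calc B u v ≤ B 1 v := hB_mono u hu 1 hone v hv hu.2
          _ = v := by rw [hB 1 hone v hv, hφ_one, zero_add, hψφ v hv]
          _ ≤ ε := h
      · have h1 := hφ_anti hε hv h
        obtain ⟨x, hx, hφx⟩ := intermediate_value_Icc' hu.2
          (hφ_cont.mono fun x hx => ⟨hu.1.trans_le hx.1, hx.2⟩)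
          (show φ ε - φ v ∈ Set.Icc (φ 1) (φ u) from
            ⟨by rw [hφ_one]; linarith, by linarith [hlt ε hε]⟩)
        have hx' : x ∈ Set.Ioc (0:ℝ) 1 := ⟨hu.1.trans_le hx.1, hx.2⟩
        calc B u v ≤ B x v := hB_mono u hu x hx' v hv hx.1
          _ = ε := by
            rw [hB x hx' v hv, hφx, sub_add_cancel, hψφ ε hε]
    by_contra! hpos
    have := hsmall (min 1 (B u v / 2)) ⟨lt_min one_pos (by linarith), min_le_left _ _⟩
    linarith [min_le_right 1 (B u v / 2)]

/-- An Archimedean operation vanishing at zero is associative. -/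
lemma archimedean_assoc {φ ψ : ℝ → ℝ} {B : ℝ → ℝ → ℝ}
    (hφ_nonneg : ∀ x ∈ Set.Ioc (0:ℝ) 1, 0 ≤ φ x)
    (hB : ∀ a ∈ Set.Ioc (0:ℝ) 1, ∀ b ∈ Set.Ioc (0:ℝ) 1, B a b = ψ (φ a + φ b))
    (hB_left : ∀ b, B 0 b = 0) (hB_right : ∀ a, B a 0 = 0)
    (hdich : ∀ u ∈ Set.Ioc (0:ℝ) 1, ∀ v ∈ Set.Ioc (0:ℝ) 1,
      (B u v ∈ Set.Ioc (0:ℝ) 1 ∧ φ (B u v) = φ u + φ v) ∨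
      (B u v = 0 ∧ ∀ t ∈ Set.Ioc (0:ℝ) 1, φ t < φ u + φ v))
    {a b c : ℝ} (ha : a ∈ Set.Icc (0:ℝ) 1) (hb : b ∈ Set.Icc (0:ℝ) 1)
    (hc : c ∈ Set.Icc (0:ℝ) 1) : B (B a b) c = B a (B b c) := by
  rcases ha.1.eq_or_lt with rfl | ha0
  · simp [hB_left]
  rcases hb.1.eq_or_lt with rfl | hb0
  · simp [hB_left, hB_right]
  rcases hc.1.eq_or_lt with rfl | hc0
  · simp [hB_right]
  replace ha : a ∈ Set.Ioc (0:ℝ) 1 := ⟨ha0, ha.2⟩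
  replace hb : b ∈ Set.Ioc (0:ℝ) 1 := ⟨hb0, hb.2⟩
  replace hc : c ∈ Set.Ioc (0:ℝ) 1 := ⟨hc0, hc.2⟩
  rcases hdich a ha b hb with ⟨h1, h1'⟩ | ⟨h1, h1'⟩ <;>
    rcases hdich b hb c hc with ⟨h2, h2'⟩ | ⟨h2, h2'⟩
  · rw [hB _ h1 c hc, hB a ha _ h2, h1', h2', add_assoc]
  · rw [h2, hB_right]
    rcases hdich _ h1 c hc with ⟨h3, h3'⟩ | ⟨h3, -⟩
    · linarith [h2' _ h3, hφ_nonneg a ha]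
    · exact h3
  · rw [h1, hB_left]
    rcases hdich a ha _ h2 with ⟨h3, h3'⟩ | ⟨h3, -⟩
    · linarith [h1' _ h3, hφ_nonneg c hc]
    · exact h3.symm
  · rw [h1, h2, hB_left, hB_right]

/-- An Archimedean copula whose conditional distribution given the first coordinate is continuous
and agrees at `0` and `1` is the independence copula. -/
lemma archimedean_eq_mul {φ ψ : ℝ → ℝ} {p : ℝ → ℝ → ℝ}
    (hφ_cont : ContinuousOn φ (Set.Ioc 0 1))
    (hφ_anti : StrictAntiOn φ (Set.Ioc 0 1))
    (hφ_nonneg : ∀ x ∈ Set.Ioc (0:ℝ) 1, 0 ≤ φ x)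
    (hψφ : ∀ x ∈ Set.Ioc (0:ℝ) 1, ψ (φ x) = x)
    (hφ_one : φ 1 = 0)
    (hp_cont : ∀ v, Continuous fun x => p x v)
    (hp_nonneg : ∀ x v, 0 ≤ v → 0 ≤ p x v)
    (hp_zero : ∀ x, p x 0 = 0)
    (hp_ends : ∀ v, p 1 v = p 0 v)
    (hP_cont : Continuous (p 0)) (hP_one : p 0 1 = 1)
    (hB : ∀ a ∈ Set.Ioc (0:ℝ) 1, ∀ b ∈ Set.Ioc (0:ℝ) 1,
      ∫ x in (0:ℝ)..a, p x b = ψ (φ a + φ b))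
    {a b : ℝ} (ha : a ∈ Set.Ioc (0:ℝ) 1) (hb : b ∈ Set.Ioc (0:ℝ) 1) :
    ψ (φ a + φ b) = a * b := by
  set B : ℝ → ℝ → ℝ := fun u v => ∫ x in (0:ℝ)..u, p x v with hBdef
  replace hB : ∀ a ∈ Set.Ioc (0:ℝ) 1, ∀ b ∈ Set.Ioc (0:ℝ) 1, B a b = ψ (φ a + φ b) := hB
  have hone : (1:ℝ) ∈ Set.Ioc (0:ℝ) 1 := Set.right_mem_Ioc.2 one_pos
  have hint : ∀ v u w, IntervalIntegrable (fun x => p x v) volume u w :=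
    fun v u w => (hp_cont v).intervalIntegrable u w
  have hB_nonneg : ∀ a ∈ Set.Ioc (0:ℝ) 1, ∀ b ∈ Set.Ioc (0:ℝ) 1, 0 ≤ B a b :=
    fun a ha b hb => intervalIntegral.integral_nonneg ha.1.le fun x _ => hp_nonneg x b hb.1.le
  have hB_sub : ∀ a a' b, B a' b - B a b = ∫ x in a..a', p x b :=
    fun a a' b => intervalIntegral.integral_interval_sub_left (hint b _ _) (hint b _ _)
  have hB_mono : ∀ a ∈ Set.Ioc (0:ℝ) 1, ∀ a' ∈ Set.Ioc (0:ℝ) 1, ∀ b ∈ Set.Ioc (0:ℝ) 1,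
      a ≤ a' → B a b ≤ B a' b := by
    intro a _ a' _ b hb h
    rw [← sub_nonneg, hB_sub]
    exact intervalIntegral.integral_nonneg h fun x _ => hp_nonneg x b hb.1.le
  have hB_left : ∀ b, B 0 b = 0 := fun b => intervalIntegral.integral_same
  have hB_right : ∀ a, B a 0 = 0 := fun a => by simp [hBdef, hp_zero]
  have hB_one : ∀ b ∈ Set.Ioc (0:ℝ) 1, B 1 b = b := fun b hb => by
    rw [hB 1 hone b hb, hφ_one, zero_add, hψφ b hb]
  have hdich : ∀ u ∈ Set.Ioc (0:ℝ) 1, ∀ v ∈ Set.Ioc (0:ℝ) 1,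
      (B u v ∈ Set.Ioc (0:ℝ) 1 ∧ φ (B u v) = φ u + φ v) ∨
      (B u v = 0 ∧ ∀ t ∈ Set.Ioc (0:ℝ) 1, φ t < φ u + φ v) := fun u hu v hv =>
    archimedean_dichotomy hφ_cont hφ_anti hφ_nonneg hψφ hφ_one hB hB_nonneg hB_mono hu hv
  have hderiv : ∀ u v, HasDerivAt (fun x => B x v) (p u v) u := fun u v =>
    (hp_cont v).integral_hasStrictDerivAt 0 u |>.hasDerivAt
  have hassoc_deriv : ∀ a ∈ Set.Icc (0:ℝ) 1, ∀ b ∈ Set.Ioc (0:ℝ) 1, ∀ c ∈ Set.Ioc (0:ℝ) 1,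
      p (B a b) c * p a b = p a (B b c) := by
    intro a ha b hb c hc
    have h1 : HasDerivWithinAt (fun x => B (B x b) c) (p (B a b) c * p a b) (Set.Icc 0 1) a :=
      (HasDerivAt.comp (h₂ := fun x => B x c) a (hderiv (B a b) c)
        (hderiv a b)).hasDerivWithinAt
    have h2 : HasDerivWithinAt (fun x => B (B x b) c) (p a (B b c)) (Set.Icc 0 1) a :=
      (hderiv a (B b c)).hasDerivWithinAt.congr_of_mem
        (fun x hx => archimedean_assoc hφ_nonneg hB hB_left hB_right hdich hx
          (Set.Ioc_subset_Icc_self hb) (Set.Ioc_subset_Icc_self hc)) ha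
    exact (uniqueDiffOn_Icc zero_lt_one a ha).eq_deriv _ h1 h2
  have hfactor : ∀ b ∈ Set.Ioc (0:ℝ) 1, 0 < p 0 b → ∀ c ∈ Set.Ioc (0:ℝ) 1, p b c = p 0 c := by
    intro b hb hpos c hc
    have h0 := hassoc_deriv 0 (by simp) b hb c hc
    have h1 := hassoc_deriv 1 (by simp) b hb c hc
    rw [hB_left] at h0
    rw [hB_one b hb, hp_ends, hp_ends, ← h0] at h1
    exact mul_right_cancel₀ hpos.ne' h1
  have hpos : ∀ b ∈ Set.Ioc (0:ℝ) 1, 0 < p 0 b := by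
    intro b hb
    refine lt_of_le_of_ne (hp_nonneg 0 b hb.1.le) fun hzero => ?_
    have hev : ∀ᶠ x in nhds (1:ℝ), 0 < p 0 x :=
      hP_cont.continuousAt.eventually_const_lt (by rw [hP_one]; exact one_pos)
    obtain ⟨δ, hδ, hball⟩ := Metric.eventually_nhds_iff.1 hev
    set y := 1 - min (δ / 2) (1 / 2) with hy
    have hm0 : 0 < min (δ / 2) (1 / 2) := lt_min (by linarith) (by norm_num)
    have hm1 := min_le_left (δ / 2) (1 / 2)
    have hm2 := min_le_right (δ / 2) (1 / 2)
    have hyI : y ∈ Set.Ioc (0:ℝ) 1 := ⟨by linarith, by linarith⟩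
    have hyp : ∀ x ∈ Set.Icc y 1, p x b = 0 := by
      intro x hx
      rw [hfactor x ⟨hyI.1.trans_le hx.1, hx.2⟩ (hball ?_) b hb, ← hzero]
      rw [Real.dist_eq, abs_lt]
      constructor <;> linarith [hx.1, hx.2]
    have hBy : B y b = b := by
      have : B 1 b - B y b = 0 := by
        rw [hB_sub, intervalIntegral.integral_congr (g := fun _ => (0:ℝ))]
        · simp
        · intro x hx
          rw [Set.uIcc_of_le hyI.2] at hx
          exact hyp x hx
      linarith [hB_one b hb]
    rcases hdich y hyI b hb with ⟨-, h⟩ | ⟨h, -⟩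
    · rw [hBy] at h
      have := hφ_anti hyI hone (by linarith)
      linarith
    · linarith [hb.1]
  have hBmul : ∀ u ∈ Set.Ioc (0:ℝ) 1, ∀ c ∈ Set.Ioc (0:ℝ) 1, B u c = u * p 0 c := by
    intro u hu c hc
    have : B u c = ∫ _ in (0:ℝ)..u, p 0 c := by
      refine intervalIntegral.integral_congr_ae (Filter.Eventually.of_forall fun x hx => ?_)
      rw [Set.uIoc_of_le hu.1.le] at hx
      have hx' : x ∈ Set.Ioc (0:ℝ) 1 := ⟨hx.1, hx.2.trans hu.2⟩
      exact hfactor x hx' (hpos x hx') c hc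
    simp [this]
  rw [← hB a ha b hb]
  change B a b = a * b
  have h := hBmul 1 hone b hb
  rw [hB_one b hb, one_mul] at h
  rw [hBmul a ha b hb, ← h]

/-- The identity or the reflection `x ↦ 1 - x`, according to the flag. -/
def reflectIf (b : Bool) (x : ℝ) : ℝ := if b then 1 - x else x

lemma continuous_reflectIf (b : Bool) : Continuous (reflectIf b) := by
  unfold reflectIf
  cases b <;> simp only [Bool.false_eq_true, if_true, if_false] <;> fun_prop

lemma fract_periodic_comp (f : ℝ → ℝ) : Function.Periodic (fun x => f (Int.fract x)) 1 :=
  fun x => by simp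

lemma integral_fract_reflectIf (f : ℝ → ℝ) (b : Bool) (t v : ℝ) :
    ∫ y in (0:ℝ)..v, f (Int.fract (t + reflectIf b y)) =
      if b then ∫ y in (t + 1 - v)..(t + 1), f (Int.fract y)
      else ∫ y in t..(t + v), f (Int.fract y) := by
  cases b
  · simpa [reflectIf] using
      intervalIntegral.integral_comp_add_left (a := 0) (b := v) (fun x => f (Int.fract x)) t
  · have := intervalIntegral.integral_comp_sub_left (a := 0) (b := v)
      (fun x => f (Int.fract x)) (t + 1)
    simpa [reflectIf, add_sub_assoc] using this

namespace IsGenerator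

lemma fract_nonneg {f : ℝ → ℝ} (hf : IsGenerator f) (x : ℝ) : 0 ≤ f (Int.fract x) :=
  hf.2.1 _ ⟨Int.fract_nonneg x, (Int.fract_lt_one x).le⟩

lemma measurable_fract {f : ℝ → ℝ} (hf : IsGenerator f) : Measurable fun x => f (Int.fract x) :=
  hf.1.comp _root_.measurable_fract

lemma integral_fract_zero_one {f : ℝ → ℝ} (hf : IsGenerator f) :
    ∫ x in (0:ℝ)..1, f (Int.fract x) = 1 := by
  rw [intervalIntegral.integral_of_le (zero_le_one' ℝ), ← integral_Icc_eq_integral_Ioc,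
    integral_Icc_eq_integral_Ico]
  refine Eq.trans ?_ (integral_Icc_eq_integral_Ico.symm.trans hf.2.2)
  refine setIntegral_congr_fun measurableSet_Ico fun x hx => ?_
  simp only [Int.fract_eq_self.2 ⟨hx.1, hx.2⟩]

lemma intervalIntegrable_fract {f : ℝ → ℝ} (hf : IsGenerator f) (a b : ℝ) :
    IntervalIntegrable (fun x => f (Int.fract x)) volume a b := by
  refine (fract_periodic_comp f).intervalIntegrable₀ one_ne_zero ?_ a b
  apply intervalIntegral.intervalIntegrable_of_integral_ne_zero
  rw [hf.integral_fract_zero_one]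
  exact one_ne_zero

lemma intervalIntegrable_reflectIf {f : ℝ → ℝ} (hf : IsGenerator f) (b : Bool) (t u v : ℝ) :
    IntervalIntegrable (fun y => f (Int.fract (t + reflectIf b y))) volume u v := by
  cases b
  · simpa [reflectIf, add_comm] using
      (hf.intervalIntegrable_fract (u + t) (v + t)).comp_add_right t
  · have h := (hf.intervalIntegrable_fract (t + 1 - u) (t + 1 - v)).comp_sub_left (t + 1)
    rw [sub_sub_cancel, sub_sub_cancel] at h
    simpa [reflectIf, add_sub_assoc] using h

lemma continuous_integral_fract {f : ℝ → ℝ} (hf : IsGenerator f)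
    {a b : ℝ → ℝ} (ha : Continuous a) (hb : Continuous b) :
    Continuous fun x => ∫ y in (a x)..(b x), f (Int.fract y) := by
  have hF := intervalIntegral.continuous_primitive hf.intervalIntegrable_fract 0
  have : (fun x => ∫ y in (a x)..(b x), f (Int.fract y)) = fun x =>
      (∫ y in (0:ℝ)..(b x), f (Int.fract y)) - ∫ y in (0:ℝ)..(a x), f (Int.fract y) := by
    funext x
    exact (intervalIntegral.integral_interval_sub_left (hf.intervalIntegrable_fract _ _)
      (hf.intervalIntegrable_fract _ _)).symm
  rw [this]
  exact (hF.comp hb).sub (hF.comp ha)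

lemma continuous_integral_reflectIf {f : ℝ → ℝ} (hf : IsGenerator f) (b : Bool) (v : ℝ) :
    Continuous fun t => ∫ y in (0:ℝ)..v, f (Int.fract (t + reflectIf b y)) := by
  simp only [integral_fract_reflectIf]
  cases b
  · simpa using hf.continuous_integral_fract continuous_id (continuous_id.add continuous_const)
  · simpa using hf.continuous_integral_fract
      ((continuous_id.add continuous_const).sub continuous_const)
      (continuous_id.add continuous_const)

lemma integral_reflectIf_one {f : ℝ → ℝ} (hf : IsGenerator f) (b : Bool) (t : ℝ) :
    ∫ y in (0:ℝ)..1, f (Int.fract (t + reflectIf b y)) = 1 := by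
  have h := (fract_periodic_comp f).intervalIntegral_add_eq t 0
  rw [zero_add, hf.integral_fract_zero_one] at h
  rw [integral_fract_reflectIf]
  cases b <;> simpa using h

lemma lintegral_reflectIf {f : ℝ → ℝ} (hf : IsGenerator f) (b : Bool) (t : ℝ) {v : ℝ} (hv : 0 ≤ v) :
    ∫⁻ y in Set.Icc 0 v, ENNReal.ofReal (f (Int.fract (t + reflectIf b y))) =
      ENNReal.ofReal (∫ y in (0:ℝ)..v, f (Int.fract (t + reflectIf b y))) := by
  rw [intervalIntegral.integral_of_le hv, ← integral_Icc_eq_integral_Ioc,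
    ofReal_integral_eq_lintegral_ofReal]
  · exact (integrableOn_Icc_iff_integrableOn_Ioc).2
      ((intervalIntegrable_iff_integrableOn_Ioc_of_le hv).1
        (hf.intervalIntegrable_reflectIf b t 0 v))
  · exact Filter.Eventually.of_forall fun _ => hf.fract_nonneg _

lemma measurable_sum_reflectIf {f : ℝ → ℝ} (hf : IsGenerator f) {d : ℕ} (s : Fin d → Bool) :
    Measurable fun v : Fin d → ℝ => f (Int.fract (∑ k, reflectIf (s k) (v k))) :=
  hf.measurable_fract.comp <| Finset.measurable_sum _ fun k _ =>
    (continuous_reflectIf (s k)).measurable.comp (measurable_pi_apply k)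

lemma setIntegral_eq_toReal {f : ℝ → ℝ} (hf : IsGenerator f)
    {d : ℕ} (s : Fin d → Bool) (S : Set (Fin d → ℝ)) :
    ∫ v in S, f (Int.fract (∑ k, reflectIf (s k) (v k))) =
      (∫⁻ v in S, ENNReal.ofReal (f (Int.fract (∑ k, reflectIf (s k) (v k))))).toReal :=
  integral_eq_lintegral_of_nonneg_ae (Filter.Eventually.of_forall fun _ => hf.fract_nonneg _)
    (hf.measurable_sum_reflectIf s).aestronglyMeasurable

/-- Margins over a full period: once a coordinate is integrated over `[0,1]`, the others are
independent and uniform. -/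
lemma setIntegral_eq_prod {f : ℝ → ℝ} (hf : IsGenerator f)
    {n : ℕ} (s : Fin (n + 1) → Bool) (u : Fin (n + 1) → ℝ)
    (hu : ∀ j, 0 ≤ u j) (i : Fin (n + 1)) (hi : u i = 1) :
    ∫ v in Set.univ.pi (fun j => Set.Icc (0:ℝ) (u j)),
      f (Int.fract (∑ k, reflectIf (s k) (v k))) = ∏ j, u j := by
  rw [hf.setIntegral_eq_toReal]
  set F : (Fin (n + 1) → ℝ) → ENNReal :=
    fun v => ENNReal.ofReal (f (Int.fract (∑ k, reflectIf (s k) (v k))))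
  have hF : Measurable F := (hf.measurable_sum_reflectIf s).ennreal_ofReal
  let e := MeasurableEquiv.piFinSuccAbove (fun _ : Fin (n + 1) => ℝ) i
  have hpre : Set.univ.pi (fun j => Set.Icc (0:ℝ) (u j)) =
      e ⁻¹' (Set.Icc 0 (u i) ×ˢ Set.univ.pi (fun j => Set.Icc (0:ℝ) (u (i.succAbove j)))) := by
    ext v
    simp only [Set.mem_univ_pi, Set.mem_preimage, Set.mem_prod]
    exact Fin.forall_iff_succAbove i
  have h1 := (volume_preserving_piFinSuccAbove (fun _ : Fin (n + 1) => ℝ) i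
    ).setLIntegral_comp_preimage_emb e.measurableEmbedding (fun z => F (e.symm z))
    (Set.Icc 0 (u i) ×ˢ Set.univ.pi (fun j => Set.Icc (0:ℝ) (u (i.succAbove j))))
  have h2 : ∀ v, F (e.symm (MeasurableEquiv.piFinSuccAbove (fun _ => ℝ) i v)) = F v :=
    fun v => congrArg F (e.symm_apply_apply v)
  simp only [h2] at h1
  rw [hpre, h1, Measure.volume_eq_prod, setLIntegral_prod_symm _
    (show Measurable fun z => F (e.symm z) from hF.comp e.symm.measurable).aemeasurable]
  have h3 : ∀ (x : ℝ) (w : Fin n → ℝ), F (e.symm (x, w)) = ENNReal.ofReal (f (Int.fract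
      ((∑ k, reflectIf (s (i.succAbove k)) (w k)) + reflectIf (s i) x))) := by
    intro x w
    change F (i.insertNth x w) = _
    simp only [F]
    rw [Fin.sum_univ_succAbove _ i, add_comm]
    simp
  simp only [h3, hi, hf.lintegral_reflectIf _ _ zero_le_one, hf.integral_reflectIf_one]
  rw [Fin.prod_univ_succAbove _ i, hi]
  simp [Set.pi_univ_Icc, Real.volume_Icc_pi, ENNReal.toReal_prod, hu]

lemma setIntegral_fin_two {f : ℝ → ℝ} (hf : IsGenerator f)
    (s : Fin 2 → Bool) {a b : ℝ} (ha : 0 ≤ a) (hb : 0 ≤ b) :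
    ∫ v in Set.univ.pi (fun j => Set.Icc (0:ℝ) (![a, b] j)),
      f (Int.fract (∑ k, reflectIf (s k) (v k))) =
    ∫ x in (0:ℝ)..a, ∫ y in (0:ℝ)..b, f (Int.fract (reflectIf (s 0) x + reflectIf (s 1) y)) := by
  rw [hf.setIntegral_eq_toReal]
  set F : (Fin 2 → ℝ) → ENNReal :=
    fun v => ENNReal.ofReal (f (Int.fract (∑ k, reflectIf (s k) (v k))))
  have hF : Measurable F := (hf.measurable_sum_reflectIf s).ennreal_ofReal
  let e := MeasurableEquiv.finTwoArrow (α := ℝ)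
  have hpre : Set.univ.pi (fun j => Set.Icc (0:ℝ) (![a, b] j)) =
      e ⁻¹' (Set.Icc 0 a ×ˢ Set.Icc 0 b) := by
    ext v
    simp only [Set.mem_univ_pi, Set.mem_preimage, Set.mem_prod]
    exact Fin.forall_fin_two
  have h1 := (volume_preserving_finTwoArrow ℝ).setLIntegral_comp_preimage_emb
    e.measurableEmbedding (fun z => F (e.symm z)) (Set.Icc 0 a ×ˢ Set.Icc 0 b)
  have h2 : ∀ v, F (e.symm (MeasurableEquiv.finTwoArrow v)) = F v :=
    fun v => congrArg F (e.symm_apply_apply v)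
  simp only [h2] at h1
  rw [hpre, h1, Measure.volume_eq_prod, setLIntegral_prod _
    (show Measurable fun z => F (e.symm z) from hF.comp e.symm.measurable).aemeasurable]
  have h3 : ∀ x y : ℝ, F (e.symm (x, y)) = ENNReal.ofReal (f (Int.fract
      (reflectIf (s 0) x + reflectIf (s 1) y))) := by
    intro x y
    change F ![x, y] = _
    simp [F]
  simp only [h3, hf.lintegral_reflectIf _ _ hb]
  rw [intervalIntegral.integral_of_le ha, ← integral_Icc_eq_integral_Ioc,
    integral_eq_lintegral_of_nonneg_ae]
  · exact Filter.Eventually.of_forall fun x =>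
      intervalIntegral.integral_nonneg hb fun _ _ => hf.fract_nonneg _
  · exact ((hf.continuous_integral_reflectIf (s 1) b).comp
      (continuous_reflectIf (s 0))).aestronglyMeasurable

end IsGenerator

theorem stmt_5 (d : ℕ) (hd : 2 ≤ d) (s : Fin d → Bool) (f : ℝ → ℝ) (hf : IsGenerator f)
    (C : (Fin d → ℝ) → ℝ)
    (hC : ∀ u : Fin d → ℝ, C u =
      ∫ v in Set.univ.pi (fun j : Fin d => Set.Icc (0:ℝ) (u j)),
        f (Int.fract (∑ k : Fin d, if s k then 1 - v k else v k)))
    (φ ψ : ℝ → ℝ)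
    (hφ_cont : ContinuousOn φ (Set.Ioc 0 1))
    (hφ_anti : StrictAntiOn φ (Set.Ioc 0 1))
    (hφ_one : φ 1 = 0)
    (hφ_nonneg : ∀ x ∈ Set.Ioc (0:ℝ) 1, 0 ≤ φ x)
    (hψ_range : ∀ x : ℝ, 0 ≤ x → ψ x ∈ Set.Icc (0:ℝ) 1)
    (hψφ : ∀ x ∈ Set.Ioc (0:ℝ) 1, ψ (φ x) = x)
    (hArch : ∀ u ∈ Set.univ.pi (fun _ : Fin d => Set.Ioc (0:ℝ) 1),
      C u = ψ (∑ j : Fin d, φ (u j))) :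
    ∀ u ∈ Set.univ.pi (fun _ : Fin d => Set.Icc (0:ℝ) 1), C u = ∏ j : Fin d, u j := by
  have hC' : ∀ u : Fin d → ℝ, C u = ∫ v in Set.univ.pi (fun j : Fin d => Set.Icc (0:ℝ) (u j)),
      f (Int.fract (∑ k, reflectIf (s k) (v k))) := hC
  have hmul : ∀ a ∈ Set.Ioc (0:ℝ) 1, ∀ b ∈ Set.Ioc (0:ℝ) 1, ψ (φ a + φ b) = a * b := by
    obtain ⟨m, rfl⟩ := Nat.exists_eq_add_of_le' hd
    cases m with
    | zero =>
      intro a ha b hb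
      refine archimedean_eq_mul hφ_cont hφ_anti hφ_nonneg hψφ hφ_one
        (p := fun x v => ∫ y in (0:ℝ)..v,
          f (Int.fract (reflectIf (s 0) x + reflectIf (s 1) y)))
        (fun v => (hf.continuous_integral_reflectIf (s 1) v).comp (continuous_reflectIf (s 0)))
        (fun x v hv => intervalIntegral.integral_nonneg hv fun _ _ => hf.fract_nonneg _)
        (fun x => intervalIntegral.integral_same) (fun v => ?_)
        (intervalIntegral.continuous_primitive (hf.intervalIntegrable_reflectIf (s 1) _) 0)
        (hf.integral_reflectIf_one (s 1) _) (fun a ha b hb => ?_) ha hb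
      · refine intervalIntegral.integral_congr fun y _ => ?_
        cases s 0 <;> simp [reflectIf]
      · have h := hArch ![a, b] (by
          rw [Set.mem_univ_pi]
          exact Fin.forall_fin_two.2 ⟨ha, hb⟩)
        rw [hC', hf.setIntegral_fin_two s ha.1.le hb.1.le] at h
        simpa using h
    | succ m =>
      intro a ha b hb
      have hu : ∀ j, (Fin.cons a (Fin.cons b fun _ => 1) : Fin (m + 1 + 2) → ℝ) j ∈
          Set.Ioc (0:ℝ) 1 := by
        refine Fin.cases ha (Fin.cases hb fun _ => ?_)
        simp
      have h := hArch (Fin.cons a (Fin.cons b fun _ => 1)) (Set.mem_univ_pi.2 hu)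
      rw [hC', hf.setIntegral_eq_prod s _ (fun j => (hu j).1.le) (Fin.succ (Fin.succ 0))
        rfl] at h
      simpa [Fin.sum_univ_succ, Fin.prod_univ_succ, hφ_one] using h.symm
  intro u hu
  rw [Set.mem_univ_pi] at hu
  by_cases hz : ∃ j, u j = 0
  · obtain ⟨j, hj⟩ := hz
    rw [Finset.prod_eq_zero (Finset.mem_univ j) hj, hC']
    refine setIntegral_measure_zero _ ?_
    rw [Set.pi_univ_Icc, Real.volume_Icc_pi]
    exact Finset.prod_eq_zero (Finset.mem_univ j) (by simp [hj])
  · push Not at hz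
    have hu' : ∀ j, u j ∈ Set.Ioc (0:ℝ) 1 :=
      fun j => ⟨lt_of_le_of_ne (hu j).1 (hz j).symm, (hu j).2⟩
    have hsum : ∀ S : Finset (Fin d),
        ∏ j ∈ S, u j ∈ Set.Ioc (0:ℝ) 1 ∧ φ (∏ j ∈ S, u j) = ∑ j ∈ S, φ (u j) := by
      intro S
      refine ⟨⟨Finset.prod_pos fun j _ => (hu' j).1,
        Finset.prod_le_one (fun j _ => (hu' j).1.le) fun j _ => (hu' j).2⟩, ?_⟩
      induction S using Finset.induction_on with
      | empty => simpa using hφ_one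
      | insert j S hj ih =>
        rw [Finset.prod_insert hj, Finset.sum_insert hj, ← ih]
        exact generator_mul hφ_cont hφ_anti hφ_nonneg hψφ hφ_one hmul (hu' j)
          ⟨Finset.prod_pos fun j _ => (hu' j).1,
            Finset.prod_le_one (fun j _ => (hu' j).1.le) fun j _ => (hu' j).2⟩
    rw [hArch u (Set.mem_univ_pi.2 hu'), ← (hsum Finset.univ).2, hψφ _ (hsum Finset.univ).1]
end

section
/- For every generator f, letting X, X' be independent random variables each with density f, the quantity T(f) := 4 E[X(1−X)] + 2 E|X − X'| − 4 Var(X) − 1 satisfies T(f) ≤ 1/6, with equality if and only if f equals the Unif(1/4, 3/4) density x ↦ 2·1{1/4 ≤ x ≤ 3/4} almost everywhere on [0,1]. Consequently, for a fixed signature s ∈ {0,1}², the range of Kendall's tau over the bivariate copulas generated by all generators f is (−1, 1/6] when s₁ = s₂ and [−1/6, 1) when s₁ ≠ s₂. -/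
open MeasureTheory

/-- `T(f) = 4 E[X(1-X)] + 2 E|X - X'| - 4 Var(X) - 1` for `X, X'` iid with density `f`. -/
noncomputable def kendallT (f : ℝ → ℝ) : ℝ :=
  4 * (∫ x in Set.Icc (0:ℝ) 1, x * (1 - x) * f x)
  + 2 * (∫ u in Set.univ.pi (fun _ : Fin 2 => Set.Icc (0:ℝ) 1),
      |u 0 - u 1| * (f (u 0) * f (u 1)))
  - 4 * ((∫ x in Set.Icc (0:ℝ) 1, x ^ 2 * f x)
      - (∫ x in Set.Icc (0:ℝ) 1, x * f x) ^ 2)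
  - 1


open intervalIntegral

theorem AbsolutelyContinuousOnInterval.integral_eq_sub_of_ae_hasDerivAt {F f : ℝ → ℝ} {a b : ℝ}
    (hF : AbsolutelyContinuousOnInterval F a b)
    (h : ∀ᵐ x, x ∈ Set.uIcc a b → HasDerivAt F (f x) x) :
    ∫ x in a..b, f x = F b - F a := by
  rw [← hF.integral_deriv_eq_sub]
  refine integral_congr_ae ?_
  filter_upwards [h] with x hx hxab
  exact (hx (Set.uIoc_subset_uIcc hxab)).deriv.symm

/-- The primitive of a locally integrable function, based at `0`. -/
noncomputable def primitiveFun (f : ℝ → ℝ) (x : ℝ) : ℝ := ∫ t in (0:ℝ)..x, f t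

section Primitive

variable {f g : ℝ → ℝ}

theorem primitiveFun_absolutelyContinuous (hf : IntervalIntegrable f volume 0 1) :
    AbsolutelyContinuousOnInterval (primitiveFun f) 0 1 :=
  hf.absolutelyContinuousOnInterval_intervalIntegral (by simp)

theorem primitiveFun_ae_hasDerivAt (hf : IntervalIntegrable f volume 0 1) :
    ∀ᵐ x, x ∈ Set.uIcc (0:ℝ) 1 → HasDerivAt (primitiveFun f) (f x) x := by
  filter_upwards [hf.ae_hasDerivAt_integral] with x hx hx'
  exact hx hx' 0 (by simp)

theorem primitiveFun_continuousOn (hf : IntervalIntegrable f volume 0 1) :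
    ContinuousOn (primitiveFun f) (Set.uIcc 0 1) :=
  (primitiveFun_absolutelyContinuous hf).continuousOn

@[simp] theorem primitiveFun_zero : primitiveFun f 0 = 0 := by simp [primitiveFun]

theorem integral_primitiveFun_mul_add (hf : IntervalIntegrable f volume 0 1)
    (hg : IntervalIntegrable g volume 0 1) :
    ∫ x in (0:ℝ)..1, (primitiveFun f x * g x + primitiveFun g x * f x)
      = primitiveFun f 1 * primitiveFun g 1 := by
  rw [((primitiveFun_absolutelyContinuous hf).fun_mul
    (primitiveFun_absolutelyContinuous hg)).integral_eq_sub_of_ae_hasDerivAt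
    (f := fun x => primitiveFun f x * g x + primitiveFun g x * f x)]
  · simp
  · filter_upwards [primitiveFun_ae_hasDerivAt hf, primitiveFun_ae_hasDerivAt hg] with x h1 h2 hx
    convert! (h1 hx).fun_mul (h2 hx) using 1
    ring

theorem integral_cube_deriv (hg : IntervalIntegrable g volume 0 1) (c : ℝ) :
    ∫ x in (0:ℝ)..1, (primitiveFun g x + c) ^ 2 * g x
      = ((primitiveFun g 1 + c) ^ 3 - c ^ 3) / 3 := by
  have hac : AbsolutelyContinuousOnInterval (fun x => primitiveFun g x + c) 0 1 := by
    refine (primitiveFun_absolutelyContinuous hg).fun_add ?_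
    exact ((LipschitzWith.const c).lipschitzOnWith (s := Set.uIcc (0:ℝ) 1)).absolutelyContinuousOnInterval
  have h3 := ((hac.fun_mul hac).fun_mul hac).const_mul (1 / 3)
  rw [h3.integral_eq_sub_of_ae_hasDerivAt (f := fun x => (primitiveFun g x + c) ^ 2 * g x)]
  · simp; ring
  · filter_upwards [primitiveFun_ae_hasDerivAt hg] with x h1 hx
    have h1 := (h1 hx).add_const c
    convert! ((h1.fun_mul h1).fun_mul h1).const_mul (1 / 3) using 1
    ring

end Primitive

theorem integral_pi_abs_sub {f : ℝ → ℝ} (hf : IntegrableOn f (Set.Icc 0 1)) :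
    ∫ u in Set.univ.pi (fun _ : Fin 2 => Set.Icc (0:ℝ) 1),
      |u 0 - u 1| * (f (u 0) * f (u 1))
      = ∫ x in (0:ℝ)..1, (∫ y in (0:ℝ)..1, |x - y| * f y) * f x := by
  have h1 := (volume_preserving_finTwoArrow ℝ).setIntegral_preimage_emb
    (MeasurableEquiv.measurableEmbedding _)
    (fun p : ℝ × ℝ => |p.1 - p.2| * (f p.1 * f p.2)) (Set.Icc (0:ℝ) 1 ×ˢ Set.Icc (0:ℝ) 1)
  have hset : (MeasurableEquiv.finTwoArrow (α := ℝ)) ⁻¹' (Set.Icc (0:ℝ) 1 ×ˢ Set.Icc (0:ℝ) 1)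
      = Set.univ.pi (fun _ : Fin 2 => Set.Icc (0:ℝ) 1) := by
    ext u
    simp only [MeasurableEquiv.finTwoArrow, Set.mem_preimage, Set.mem_prod, Set.mem_pi,
      Fin.forall_fin_two]
    simp
  rw [hset] at h1
  have hint : IntegrableOn (fun p : ℝ × ℝ => |p.1 - p.2| * (f p.1 * f p.2))
      (Set.Icc (0:ℝ) 1 ×ˢ Set.Icc (0:ℝ) 1) := by
    have hff : IntegrableOn (fun p : ℝ × ℝ => f p.1 * f p.2)
        (Set.Icc (0:ℝ) 1 ×ˢ Set.Icc (0:ℝ) 1) := by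
      rw [IntegrableOn, Measure.volume_eq_prod, ← Measure.prod_restrict]
      exact Integrable.mul_prod hf hf
    exact hff.continuousOn_mul (by fun_prop) (isCompact_Icc.prod isCompact_Icc)
  refine h1.trans ?_
  rw [Measure.volume_eq_prod] at hint ⊢
  rw [setIntegral_prod _ hint, integral_Icc_eq_integral_Ioc, integral_of_le zero_le_one]
  congr 1
  ext x
  rw [integral_of_le zero_le_one, ← integral_Icc_eq_integral_Ioc, 
    ← MeasureTheory.integral_mul_const]
  congr 1
  ext y
  ring

theorem integral_abs_sub_mul {f : ℝ → ℝ} (hf : IntervalIntegrable f volume 0 1) {x : ℝ}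
    (hx : x ∈ Set.Icc (0:ℝ) 1) :
    ∫ y in (0:ℝ)..1, |x - y| * f y
      = 2 * x * primitiveFun f x - 2 * primitiveFun (fun y => y * f y) x
        + primitiveFun (fun y => y * f y) 1 - x * primitiveFun f 1 := by
  have hyf : IntervalIntegrable (fun y => y * f y) volume 0 1 :=
    hf.continuousOn_mul continuousOn_id
  have h0x : Set.uIcc 0 x ⊆ Set.uIcc (0:ℝ) 1 := by
    rw [Set.uIcc_of_le hx.1, Set.uIcc_of_le zero_le_one]; exact Set.Icc_subset_Icc_right hx.2
  have hx1 : Set.uIcc x 1 ⊆ Set.uIcc (0:ℝ) 1 := by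
    rw [Set.uIcc_of_le hx.2, Set.uIcc_of_le zero_le_one]; exact Set.Icc_subset_Icc_left hx.1
  have habs : IntervalIntegrable (fun y => |x - y| * f y) volume 0 1 :=
    hf.continuousOn_mul (by fun_prop)
  have e1 : ∫ y in (0:ℝ)..x, |x - y| * f y
      = x * primitiveFun f x - primitiveFun (fun y => y * f y) x := by
    rw [primitiveFun, primitiveFun, ← intervalIntegral.integral_const_mul,
      ← intervalIntegral.integral_sub ((hf.mono_set h0x).const_mul x) (hyf.mono_set h0x)]
    refine integral_congr fun y hy => ?_
    rw [Set.uIcc_of_le hx.1] at hy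
    simp only [abs_of_nonneg (sub_nonneg.2 hy.2)]
    ring
  have e2 : ∫ y in x..1, |x - y| * f y
      = (∫ y in x..1, y * f y) - x * ∫ y in x..1, f y := by
    rw [← intervalIntegral.integral_const_mul,
      ← intervalIntegral.integral_sub (hyf.mono_set hx1) ((hf.mono_set hx1).const_mul x)]
    refine integral_congr fun y hy => ?_
    rw [Set.uIcc_of_le hx.2] at hy
    simp only [abs_of_nonpos (sub_nonpos.2 hy.1)]
    ring
  have e3 := integral_add_adjacent_intervals (hf.mono_set h0x) (hf.mono_set hx1)
  have e4 := integral_add_adjacent_intervals (hyf.mono_set h0x) (hyf.mono_set hx1)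
  rw [← integral_add_adjacent_intervals (habs.mono_set h0x) (habs.mono_set hx1), e1, e2]
  simp only [primitiveFun]
  rw [← e3, ← e4]
  ring

namespace IsGenerator

variable {f : ℝ → ℝ}

theorem integrableOn (hf : IsGenerator f) : IntegrableOn f (Set.Icc 0 1) := by
  by_contra h
  have := hf.2.2
  rw [integral_undef h] at this
  exact zero_ne_one this

theorem intervalIntegrable (hf : IsGenerator f) : IntervalIntegrable f volume 0 1 :=
  (intervalIntegrable_iff_integrableOn_Icc_of_le zero_le_one).2 hf.integrableOn

theorem mul_intervalIntegrable (hf : IsGenerator f) {g : ℝ → ℝ}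
    (hg : ContinuousOn g (Set.uIcc 0 1)) :
    IntervalIntegrable (fun x => g x * f x) volume 0 1 :=
  hf.intervalIntegrable.continuousOn_mul hg

theorem primitiveFun_one (hf : IsGenerator f) : primitiveFun f 1 = 1 := by
  rw [primitiveFun, integral_of_le zero_le_one, ← integral_Icc_eq_integral_Ioc, hf.2.2]

theorem continuousOn_primitiveFun (hf : IsGenerator f) :
    ContinuousOn (primitiveFun f) (Set.uIcc 0 1) :=
  primitiveFun_continuousOn hf.intervalIntegrable

theorem integral_primitiveFun_mul (hf : IsGenerator f) :
    ∫ x in (0:ℝ)..1, primitiveFun f x * f x = 1 / 2 := by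
  have h := integral_primitiveFun_mul_add hf.intervalIntegrable hf.intervalIntegrable
  have hi := hf.mul_intervalIntegrable hf.continuousOn_primitiveFun
  rw [intervalIntegral.integral_add hi hi, hf.primitiveFun_one] at h
  linarith

theorem integral_primitiveFun_sq_mul (hf : IsGenerator f) :
    ∫ x in (0:ℝ)..1, primitiveFun f x ^ 2 * f x = 1 / 3 := by
  have h := integral_cube_deriv hf.intervalIntegrable 0
  simp only [add_zero, hf.primitiveFun_one] at h
  linarith

theorem integral_integral_abs_sub (hf : IsGenerator f) :
    ∫ x in (0:ℝ)..1, (∫ y in (0:ℝ)..1, |x - y| * f y) * f x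
      = 4 * (∫ x in (0:ℝ)..1, x * primitiveFun f x * f x) - 2 * ∫ x in (0:ℝ)..1, x * f x := by
  have hyf : IntervalIntegrable (fun y => y * f y) volume 0 1 :=
    hf.mul_intervalIntegrable continuousOn_id
  have hF := hf.continuousOn_primitiveFun
  have hM := primitiveFun_continuousOn hyf
  have hxF : IntervalIntegrable (fun x => x * primitiveFun f x * f x) volume 0 1 :=
    hf.mul_intervalIntegrable (continuousOn_id.fun_mul hF)
  have hMf := hf.mul_intervalIntegrable hM
  have hparts := integral_primitiveFun_mul_add hf.intervalIntegrable hyf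
  have hFyf : IntervalIntegrable (fun x => primitiveFun f x * (x * f x)) volume 0 1 :=
    hyf.continuousOn_mul hF
  rw [intervalIntegral.integral_add hFyf hMf, hf.primitiveFun_one, one_mul] at hparts
  have hcomm : ∫ x in (0:ℝ)..1, primitiveFun f x * (x * f x)
      = ∫ x in (0:ℝ)..1, x * primitiveFun f x * f x :=
    integral_congr fun x _ => by ring
  have hm : primitiveFun (fun y => y * f y) 1 = ∫ x in (0:ℝ)..1, x * f x := rfl
  have hf1 : ∫ x in (0:ℝ)..1, f x = 1 := hf.primitiveFun_one
  have hexp : ∫ x in (0:ℝ)..1, (∫ y in (0:ℝ)..1, |x - y| * f y) * f x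
      = ∫ x in (0:ℝ)..1, (2 * (x * primitiveFun f x * f x)
        - 2 * (primitiveFun (fun y => y * f y) x * f x)
        + (∫ x in (0:ℝ)..1, x * f x) * f x - x * f x) := by
    refine integral_congr fun x hx => ?_
    rw [Set.uIcc_of_le zero_le_one] at hx
    simp only [integral_abs_sub_mul hf.intervalIntegrable hx, hf.primitiveFun_one, hm]
    ring
  rw [hexp, intervalIntegral.integral_sub
      (((hxF.const_mul 2).sub (hMf.const_mul 2)).add (hf.intervalIntegrable.const_mul _)) hyf,
    intervalIntegral.integral_add ((hxF.const_mul 2).sub (hMf.const_mul 2))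
      (hf.intervalIntegrable.const_mul _),
    intervalIntegral.integral_sub (hxF.const_mul 2) (hMf.const_mul 2),
    intervalIntegral.integral_const_mul, intervalIntegral.integral_const_mul,
    intervalIntegral.integral_const_mul, hf1]
  linarith

theorem kendallT_eq_moments (hf : IsGenerator f) :
    kendallT f = 4 * (∫ x in (0:ℝ)..1, x * (1 - x) * f x)
      + 2 * (∫ x in (0:ℝ)..1, (∫ y in (0:ℝ)..1, |x - y| * f y) * f x)
      - 4 * ((∫ x in (0:ℝ)..1, x ^ 2 * f x) - (∫ x in (0:ℝ)..1, x * f x) ^ 2) - 1 := by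
  simp only [kendallT, integral_pi_abs_sub hf.integrableOn, integral_Icc_eq_integral_Ioc,
    integral_of_le (zero_le_one (α := ℝ))]

theorem kendallT_eq (hf : IsGenerator f) :
    kendallT f = 1 / 6
      - 8 * (∫ x in (0:ℝ)..1, (x - primitiveFun f x / 2 - 1 / 4) ^ 2 * f x)
      + 4 * (∫ x in (0:ℝ)..1, (x - primitiveFun f x / 2 - 1 / 4) * f x) ^ 2 := by
  have hF := hf.continuousOn_primitiveFun
  have h1 : IntervalIntegrable (fun x => x * f x) volume 0 1 :=
    hf.mul_intervalIntegrable continuousOn_id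
  have h2 : IntervalIntegrable (fun x => x ^ 2 * f x) volume 0 1 :=
    hf.mul_intervalIntegrable (continuousOn_id.fun_pow 2)
  have hFf := hf.mul_intervalIntegrable hF
  have hFFf := hf.mul_intervalIntegrable (hF.fun_pow 2)
  have hxF : IntervalIntegrable (fun x => x * primitiveFun f x * f x) volume 0 1 :=
    hf.mul_intervalIntegrable (continuousOn_id.fun_mul hF)
  have h0 := hf.intervalIntegrable
  have hf1 : ∫ x in (0:ℝ)..1, f x = 1 := hf.primitiveFun_one
  have e1 : ∫ x in (0:ℝ)..1, x * (1 - x) * f x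
      = (∫ x in (0:ℝ)..1, x * f x) - ∫ x in (0:ℝ)..1, x ^ 2 * f x := by
    rw [← intervalIntegral.integral_sub h1 h2]
    exact integral_congr fun x _ => by ring
  have e2 : ∫ x in (0:ℝ)..1, (x - primitiveFun f x / 2 - 1 / 4) * f x
      = (∫ x in (0:ℝ)..1, x * f x) - 1 / 2 := by
    have : ∫ x in (0:ℝ)..1, (x - primitiveFun f x / 2 - 1 / 4) * f x
        = ∫ x in (0:ℝ)..1, (x * f x - 1 / 2 * (primitiveFun f x * f x) - 1 / 4 * f x) :=
      integral_congr fun x _ => by ring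
    rw [this, intervalIntegral.integral_sub (h1.sub (hFf.const_mul _)) (h0.const_mul _),
      intervalIntegral.integral_sub h1 (hFf.const_mul _), intervalIntegral.integral_const_mul,
      intervalIntegral.integral_const_mul, hf.integral_primitiveFun_mul, hf1]
    ring
  have e3 : ∫ x in (0:ℝ)..1, (x - primitiveFun f x / 2 - 1 / 4) ^ 2 * f x
      = (∫ x in (0:ℝ)..1, x ^ 2 * f x) + 13 / 48 - (∫ x in (0:ℝ)..1, x * primitiveFun f x * f x)
        - 1 / 2 * ∫ x in (0:ℝ)..1, x * f x := by
    have : ∫ x in (0:ℝ)..1, (x - primitiveFun f x / 2 - 1 / 4) ^ 2 * f x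
        = ∫ x in (0:ℝ)..1, (((((x ^ 2 * f x) + 1 / 4 * (primitiveFun f x ^ 2 * f x))
          + 1 / 16 * f x) + 1 / 4 * (primitiveFun f x * f x)) - x * primitiveFun f x * f x
          - 1 / 2 * (x * f x)) :=
      integral_congr fun x _ => by ring
    have i1 := h2.add (hFFf.const_mul (1 / 4))
    have i2 := i1.add (h0.const_mul (1 / 16))
    have i3 := i2.add (hFf.const_mul (1 / 4))
    have i4 := i3.sub hxF
    rw [this, intervalIntegral.integral_sub i4 (h1.const_mul _),
      intervalIntegral.integral_sub i3 hxF, intervalIntegral.integral_add i2 (hFf.const_mul _),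
      intervalIntegral.integral_add i1 (h0.const_mul _),
      intervalIntegral.integral_add h2 (hFFf.const_mul _)]
    simp only [intervalIntegral.integral_const_mul, hf.integral_primitiveFun_mul, hf1,
      hf.integral_primitiveFun_sq_mul]
    ring
  rw [hf.kendallT_eq_moments, hf.integral_integral_abs_sub, e1, e2, e3]
  ring

theorem nonneg_of_mem (hf : IsGenerator f) {x : ℝ} (hx : x ∈ Set.Icc (0:ℝ) 1) : 0 ≤ f x :=
  hf.2.1 x hx

theorem sq_integral_mul_le (hf : IsGenerator f) {g : ℝ → ℝ}
    (hg : ContinuousOn g (Set.uIcc 0 1)) :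
    (∫ x in (0:ℝ)..1, g x * f x) ^ 2 ≤ ∫ x in (0:ℝ)..1, g x ^ 2 * f x := by
  set c := ∫ x in (0:ℝ)..1, g x * f x with hc
  have hf1 : ∫ x in (0:ℝ)..1, f x = 1 := hf.primitiveFun_one
  have hgf := hf.mul_intervalIntegrable hg
  have hggf := hf.mul_intervalIntegrable (hg.fun_pow 2)
  have hpos : 0 ≤ ∫ x in (0:ℝ)..1, (g x - c) ^ 2 * f x :=
    integral_nonneg zero_le_one fun _ hx => mul_nonneg (sq_nonneg _) (hf.nonneg_of_mem hx)
  have hexp : ∫ x in (0:ℝ)..1, (g x - c) ^ 2 * f x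
      = ∫ x in (0:ℝ)..1, (g x ^ 2 * f x - 2 * c * (g x * f x) + c ^ 2 * f x) :=
    integral_congr fun x _ => by ring
  rw [hexp, intervalIntegral.integral_add (hggf.sub (hgf.const_mul _))
      (hf.intervalIntegrable.const_mul _), intervalIntegral.integral_sub hggf (hgf.const_mul _),
    intervalIntegral.integral_const_mul, intervalIntegral.integral_const_mul, ← hc, hf1] at hpos
  linarith

theorem kendallT_le_sub (hf : IsGenerator f) :
    kendallT f ≤ 1 / 6
      - 4 * ∫ x in (0:ℝ)..1, (x - primitiveFun f x / 2 - 1 / 4) ^ 2 * f x := by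
  have hF := hf.continuousOn_primitiveFun
  have := hf.sq_integral_mul_le (g := fun x => x - primitiveFun f x / 2 - 1 / 4) (by fun_prop)
  rw [hf.kendallT_eq]
  linarith

theorem integral_sq_mul_nonneg (hf : IsGenerator f) (g : ℝ → ℝ) :
    0 ≤ ∫ x in (0:ℝ)..1, g x ^ 2 * f x :=
  integral_nonneg zero_le_one fun _ hx => mul_nonneg (sq_nonneg _) (hf.nonneg_of_mem hx)

end IsGenerator

/-- The cumulative distribution function of the uniform law on `[1/4, 3/4]`. -/
noncomputable def clampCDF (x : ℝ) : ℝ := max 0 (min 1 (2 * x - 1 / 2))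

theorem continuous_clampCDF : Continuous clampCDF := by
  unfold clampCDF
  fun_prop

theorem clampCDF_of_le {x : ℝ} (hx : x ≤ 1 / 4) : clampCDF x = 0 := by
  rw [clampCDF, min_eq_right (by linarith), max_eq_left (by linarith)]

theorem clampCDF_of_mem {x : ℝ} (hx : x ∈ Set.Icc (1 / 4 : ℝ) (3 / 4)) :
    clampCDF x = 2 * x - 1 / 2 := by
  rw [clampCDF, min_eq_right (by linarith [hx.2]), max_eq_right (by linarith [hx.1])]

theorem clampCDF_of_ge {x : ℝ} (hx : 3 / 4 ≤ x) : clampCDF x = 1 := by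
  rw [clampCDF, min_eq_left (by linarith), max_eq_right (by norm_num)]

theorem integral_clampCDF_sub_sq :
    ∫ x in (0:ℝ)..1, (clampCDF x - 2 * x + 1 / 2) ^ 2 = 1 / 24 := by
  have hc : Continuous fun x => (clampCDF x - 2 * x + 1 / 2) ^ 2 := by
    have := continuous_clampCDF
    fun_prop
  rw [← integral_add_adjacent_intervals (hc.intervalIntegrable 0 (1 / 4))
      (hc.intervalIntegrable (1 / 4) 1),
    ← integral_add_adjacent_intervals (hc.intervalIntegrable (1 / 4) (3 / 4))
      (hc.intervalIntegrable (3 / 4) 1)]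
  have e1 : ∫ x in (0:ℝ)..(1 / 4), (clampCDF x - 2 * x + 1 / 2) ^ 2
      = ∫ x in (0:ℝ)..(1 / 4), (4 * x ^ 2 - 2 * x + 1 / 4) := by
    refine integral_congr fun x hx => ?_
    rw [Set.uIcc_of_le (by norm_num)] at hx
    simp only [clampCDF_of_le hx.2]
    ring
  have e2 : ∫ x in (1 / 4 : ℝ)..(3 / 4), (clampCDF x - 2 * x + 1 / 2) ^ 2
      = ∫ x in (1 / 4 : ℝ)..(3 / 4), (0 : ℝ) := by
    refine integral_congr fun x hx => ?_
    rw [Set.uIcc_of_le (by norm_num)] at hx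
    simp only [clampCDF_of_mem hx]
    ring
  have e3 : ∫ x in (3 / 4 : ℝ)..1, (clampCDF x - 2 * x + 1 / 2) ^ 2
      = ∫ x in (3 / 4 : ℝ)..1, (4 * x ^ 2 - 6 * x + 9 / 4) := by
    refine integral_congr fun x hx => ?_
    rw [Set.uIcc_of_le (by norm_num)] at hx
    simp only [clampCDF_of_ge hx.1]
    ring
  rw [e1, e2, e3]
  have i (a b : ℝ) (g : ℝ → ℝ) (hg : Continuous g) : IntervalIntegrable g volume a b :=
    hg.intervalIntegrable a b
  rw [intervalIntegral.integral_add (i _ _ _ (by fun_prop)) (i _ _ _ (by fun_prop)),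
    intervalIntegral.integral_sub (i _ _ _ (by fun_prop)) (i _ _ _ (by fun_prop)),
    intervalIntegral.integral_add (i _ _ _ (by fun_prop)) (i _ _ _ (by fun_prop)),
    intervalIntegral.integral_sub (i _ _ _ (by fun_prop)) (i _ _ _ (by fun_prop))]
  have hlin (a b c : ℝ) : ∫ x in a..b, c * x = c * ((b ^ 2 - a ^ 2) / 2) := by
    rw [intervalIntegral.integral_const_mul, integral_id]
  simp only [hlin, intervalIntegral.integral_const_mul, integral_pow,
    intervalIntegral.integral_const, smul_eq_mul]
  norm_num

theorem clampCDF_sub_sq_le {x y : ℝ} (hy : y ∈ Set.Icc (0:ℝ) 1) :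
    (clampCDF x - 2 * x + 1 / 2) ^ 2 + (y - clampCDF x) ^ 2 ≤ (y - 2 * x + 1 / 2) ^ 2 := by
  rcases le_total x (1 / 4) with h | h
  · rw [clampCDF_of_le h]
    nlinarith [hy.1, mul_nonneg hy.1 (sub_nonneg.2 h)]
  rcases le_total x (3 / 4) with h' | h'
  · rw [clampCDF_of_mem ⟨h, h'⟩]
    nlinarith
  · rw [clampCDF_of_ge h']
    nlinarith [mul_nonneg (sub_nonneg.2 hy.2) (sub_nonneg.2 h')]

namespace IsGenerator

variable {f : ℝ → ℝ}

theorem primitiveFun_mem_Icc (hf : IsGenerator f) {x : ℝ} (hx : x ∈ Set.Icc (0:ℝ) 1) :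
    primitiveFun f x ∈ Set.Icc (0:ℝ) 1 := by
  have h0x : IntervalIntegrable f volume 0 x := hf.intervalIntegrable.mono_set <| by
    rw [Set.uIcc_of_le hx.1, Set.uIcc_of_le zero_le_one]; exact Set.Icc_subset_Icc_right hx.2
  have hx1 : IntervalIntegrable f volume x 1 := hf.intervalIntegrable.mono_set <| by
    rw [Set.uIcc_of_le hx.2, Set.uIcc_of_le zero_le_one]; exact Set.Icc_subset_Icc_left hx.1
  have h1 : 0 ≤ ∫ t in (0:ℝ)..x, f t :=
    integral_nonneg hx.1 fun t ht => hf.nonneg_of_mem ⟨ht.1, ht.2.trans hx.2⟩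
  have h2 : 0 ≤ ∫ t in x..1, f t :=
    integral_nonneg hx.2 fun t ht => hf.nonneg_of_mem ⟨hx.1.trans ht.1, ht.2⟩
  have h3 := integral_add_adjacent_intervals h0x hx1
  have h4 := hf.primitiveFun_one
  simp only [primitiveFun] at h4 ⊢
  exact ⟨h1, by linarith⟩

theorem primitiveFun_eq_clampCDF (hf : IsGenerator f)
    (h : ∫ x in (0:ℝ)..1, (x - primitiveFun f x / 2 - 1 / 4) ^ 2 * f x = 0) :
    ∀ x ∈ Set.Icc (0:ℝ) 1, primitiveFun f x = clampCDF x := by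
  have hF := hf.continuousOn_primitiveFun
  have hC := continuous_clampCDF
  have hcube : ∫ x in (0:ℝ)..1, (primitiveFun f x - 2 * x + 1 / 2) ^ 2 * (f x - 2) = -1 / 12 := by
    have hg : IntervalIntegrable (fun x => f x - 2) volume 0 1 :=
      hf.intervalIntegrable.sub intervalIntegrable_const
    have hp : ∀ x ∈ Set.Icc (0:ℝ) 1,
        primitiveFun (fun x => f x - 2) x = primitiveFun f x - 2 * x := by
      intro x hx
      rw [primitiveFun, intervalIntegral.integral_sub _ intervalIntegrable_const]
      · simp [primitiveFun, mul_comm]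
      · refine hf.intervalIntegrable.mono_set ?_
        rw [Set.uIcc_of_le hx.1, Set.uIcc_of_le zero_le_one]
        exact Set.Icc_subset_Icc_right hx.2
    have := integral_cube_deriv hg (1 / 2)
    rw [hp 1 (by simp), hf.primitiveFun_one] at this
    rw [show (-1 / 12 : ℝ) = ((1 - 2 * 1 + 1 / 2) ^ 3 - (1 / 2) ^ 3) / 3 by norm_num, ← this]
    refine integral_congr fun x hx => ?_
    rw [Set.uIcc_of_le zero_le_one] at hx
    simp only [hp x hx]
  have hsq : ∫ x in (0:ℝ)..1, (primitiveFun f x - 2 * x + 1 / 2) ^ 2 = 1 / 24 := by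
    have hexp : ∫ x in (0:ℝ)..1, (primitiveFun f x - 2 * x + 1 / 2) ^ 2 * (f x - 2)
        = ∫ x in (0:ℝ)..1, (4 * ((x - primitiveFun f x / 2 - 1 / 4) ^ 2 * f x)
          - 2 * (primitiveFun f x - 2 * x + 1 / 2) ^ 2) :=
      integral_congr fun x _ => by ring
    rw [hexp, intervalIntegral.integral_sub, intervalIntegral.integral_const_mul,
      intervalIntegral.integral_const_mul, h] at hcube
    · linarith
    · exact (hf.mul_intervalIntegrable
        (g := fun x => (x - primitiveFun f x / 2 - 1 / 4) ^ 2) (by fun_prop)).const_mul 4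
    · exact ContinuousOn.intervalIntegrable (by fun_prop)
  have hdiff : ∫ x in (0:ℝ)..1, ((primitiveFun f x - 2 * x + 1 / 2) ^ 2
      - (clampCDF x - 2 * x + 1 / 2) ^ 2) = 0 := by
    rw [intervalIntegral.integral_sub, hsq, integral_clampCDF_sub_sq, sub_self]
    · exact ContinuousOn.intervalIntegrable (by fun_prop)
    · exact ContinuousOn.intervalIntegrable (by fun_prop)
  by_contra! hne
  obtain ⟨x, hx, hne⟩ := hne
  refine (integral_pos zero_lt_one ?_ ?_ ⟨x, hx, ?_⟩).ne' hdiff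
  · rw [← Set.uIcc_of_le zero_le_one]
    fun_prop
  · intro y hy
    have := clampCDF_sub_sq_le (x := y) (hf.primitiveFun_mem_Icc (Set.Ioc_subset_Icc_self hy))
    nlinarith [sq_nonneg (primitiveFun f y - clampCDF y)]
  · have := clampCDF_sub_sq_le (x := x) (hf.primitiveFun_mem_Icc hx)
    have := sq_pos_of_ne_zero (sub_ne_zero.2 hne)
    linarith

theorem ae_eq_of_primitiveFun_eq (hf : IsGenerator f)
    (h : ∀ x ∈ Set.Icc (0:ℝ) 1, primitiveFun f x = clampCDF x) :
    ∀ᵐ x ∂(volume.restrict (Set.Icc (0:ℝ) 1)),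
      f x = if x ∈ Set.Icc (1/4 : ℝ) (3/4) then 2 else 0 := by
  rw [ae_restrict_iff' measurableSet_Icc]
  have hne (c : ℝ) : ∀ᵐ x : ℝ, x ≠ c := Measure.ae_ne volume c
  filter_upwards [primitiveFun_ae_hasDerivAt hf.intervalIntegrable, hne 0, hne 1, hne (1 / 4),
    hne (3 / 4)] with x hd h0 h1 h2 h3 hx
  rw [Set.uIcc_of_le zero_le_one] at hd
  have hx' : Set.Icc (0:ℝ) 1 ∈ nhds x :=
    Icc_mem_nhds (lt_of_le_of_ne hx.1 h0.symm) (lt_of_le_of_ne hx.2 h1)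
  have hC : HasDerivAt clampCDF (f x) x :=
    (hd hx).congr_of_eventuallyEq (by filter_upwards [hx'] with y hy using (h y hy).symm)
  rcases lt_or_gt_of_ne h2 with hlt | hgt
  · rw [if_neg (fun hm => hlt.not_ge hm.1)]
    refine hC.unique ((hasDerivAt_const x (0:ℝ)).congr_of_eventuallyEq ?_)
    filter_upwards [Iio_mem_nhds hlt] with y hy using clampCDF_of_le (le_of_lt hy)
  rcases lt_or_gt_of_ne h3 with hlt' | hgt'
  · rw [if_pos ⟨hgt.le, hlt'.le⟩]
    have hlin : HasDerivAt (fun y : ℝ => 2 * y - 1 / 2) 2 x := by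
      simpa using ((hasDerivAt_id x).const_mul 2).sub_const (1 / 2)
    refine hC.unique (hlin.congr_of_eventuallyEq ?_)
    filter_upwards [Icc_mem_nhds hgt hlt'] with y hy using clampCDF_of_mem hy
  · rw [if_neg (fun hm => hgt'.not_ge hm.2)]
    refine hC.unique ((hasDerivAt_const x (1:ℝ)).congr_of_eventuallyEq ?_)
    filter_upwards [Ioi_mem_nhds hgt'] with y hy using clampCDF_of_ge (le_of_lt hy)

theorem kendallT_congr_ae (hf : IsGenerator f) {g : ℝ → ℝ} (hg : IsGenerator g)
    (h : ∀ᵐ x ∂(volume.restrict (Set.Icc (0:ℝ) 1)), f x = g x) : kendallT f = kendallT g := by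
  rw [ae_restrict_iff' measurableSet_Icc] at h
  have hp : ∀ x ∈ Set.Icc (0:ℝ) 1, primitiveFun f x = primitiveFun g x := by
    intro x hx
    refine integral_congr_ae ?_
    filter_upwards [h] with t ht ht'
    rw [Set.uIoc_of_le hx.1] at ht'
    exact ht ⟨ht'.1.le, ht'.2.trans hx.2⟩
  have hi (G : ℝ → ℝ → ℝ) : ∫ x in (0:ℝ)..1, G x (primitiveFun f x) * f x
      = ∫ x in (0:ℝ)..1, G x (primitiveFun g x) * g x := by
    refine integral_congr_ae ?_
    filter_upwards [h] with t ht ht'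
    rw [Set.uIoc_of_le zero_le_one] at ht'
    have ht' := Set.Ioc_subset_Icc_self ht'
    rw [hp t ht', ht ht']
  rw [hf.kendallT_eq, hg.kendallT_eq, hi fun x y => (x - y / 2 - 1 / 4) ^ 2,
    hi fun x y => x - y / 2 - 1 / 4]

theorem integral_mul_one_sub_pos (hf : IsGenerator f) :
    0 < ∫ x in (0:ℝ)..1, x * (1 - x) * f x := by
  have hint := hf.mul_intervalIntegrable (g := fun x => x * (1 - x)) (by fun_prop)
  have hnn : ∀ x ∈ Set.Icc (0:ℝ) 1, 0 ≤ x * (1 - x) * f x := fun x hx =>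
    mul_nonneg (mul_nonneg hx.1 (sub_nonneg.2 hx.2)) (hf.nonneg_of_mem hx)
  rcases (integral_nonneg zero_le_one hnn).lt_or_eq with h | h
  · exact h
  exfalso
  have hz := (integral_eq_zero_iff_of_le_of_nonneg_ae zero_le_one
    ((ae_restrict_mem measurableSet_Ioc).mono fun x hx => hnn x (Set.Ioc_subset_Icc_self hx))
    hint).1 h.symm
  have hf0 : ∫ x in (0:ℝ)..1, f x = 0 := by
    rw [Filter.EventuallyEq, ae_restrict_iff' measurableSet_Ioc] at hz
    refine integral_zero_ae ?_
    filter_upwards [hz, Measure.ae_ne volume (1:ℝ)] with x hx h1 hx'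
    rw [Set.uIoc_of_le zero_le_one] at hx'
    have hlt : x < 1 := lt_of_le_of_ne hx'.2 h1
    exact (mul_eq_zero.1 (hx hx')).resolve_left (mul_pos hx'.1 (sub_pos.2 hlt)).ne'
  exact one_ne_zero (hf.primitiveFun_one.symm.trans hf0)

theorem variance_le_integral_abs_sub (hf : IsGenerator f) :
    2 * ((∫ x in (0:ℝ)..1, x ^ 2 * f x) - (∫ x in (0:ℝ)..1, x * f x) ^ 2)
      ≤ ∫ x in (0:ℝ)..1, (∫ y in (0:ℝ)..1, |x - y| * f y) * f x := by
  set m := ∫ x in (0:ℝ)..1, x * f x with hm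
  set q := ∫ x in (0:ℝ)..1, x ^ 2 * f x with hq
  have h1 : IntervalIntegrable (fun x => x * f x) volume 0 1 :=
    hf.mul_intervalIntegrable continuousOn_id
  have h2 : IntervalIntegrable (fun x => x ^ 2 * f x) volume 0 1 :=
    hf.mul_intervalIntegrable (continuousOn_id.fun_pow 2)
  have h0 := hf.intervalIntegrable
  have hf1 : ∫ x in (0:ℝ)..1, f x = 1 := hf.primitiveFun_one
  have hinner : ∀ x ∈ Set.Icc (0:ℝ) 1, x ^ 2 - 2 * m * x + q ≤ ∫ y in (0:ℝ)..1, |x - y| * f y := by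
    intro x hx
    have e : ∫ y in (0:ℝ)..1, (x - y) ^ 2 * f y = x ^ 2 - 2 * m * x + q := by
      have : ∫ y in (0:ℝ)..1, (x - y) ^ 2 * f y
          = ∫ y in (0:ℝ)..1, (x ^ 2 * f y - 2 * x * (y * f y) + y ^ 2 * f y) :=
        integral_congr fun y _ => by ring
      rw [this, intervalIntegral.integral_add ((h0.const_mul _).sub (h1.const_mul _)) h2,
        intervalIntegral.integral_sub (h0.const_mul _) (h1.const_mul _),
        intervalIntegral.integral_const_mul, intervalIntegral.integral_const_mul, hf1, ← hm, ← hq]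
      ring
    rw [← e]
    refine integral_mono_on zero_le_one (hf.mul_intervalIntegrable (by fun_prop))
      (hf.mul_intervalIntegrable (by fun_prop)) fun y hy => ?_
    refine mul_le_mul_of_nonneg_right ?_ (hf.nonneg_of_mem hy)
    have hle : |x - y| ≤ 1 := abs_le.2 ⟨by linarith [hx.1, hy.2], by linarith [hx.2, hy.1]⟩
    rw [← sq_abs]
    nlinarith [abs_nonneg (x - y)]
  have hcont : ContinuousOn (fun x => ∫ y in (0:ℝ)..1, |x - y| * f y) (Set.uIcc 0 1) := by
    have hF := hf.continuousOn_primitiveFun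
    have hM := primitiveFun_continuousOn h1
    refine ContinuousOn.congr (f := fun x => 2 * x * primitiveFun f x
      - 2 * primitiveFun (fun y => y * f y) x + primitiveFun (fun y => y * f y) 1
      - x * primitiveFun f 1) (by fun_prop) fun x hx => ?_
    rw [Set.uIcc_of_le zero_le_one] at hx
    exact integral_abs_sub_mul h0 hx
  have hmono : ∫ x in (0:ℝ)..1, (x ^ 2 - 2 * m * x + q) * f x
      ≤ ∫ x in (0:ℝ)..1, (∫ y in (0:ℝ)..1, |x - y| * f y) * f x :=
    integral_mono_on zero_le_one (hf.mul_intervalIntegrable (by fun_prop))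
      (hf.mul_intervalIntegrable hcont)
      fun x hx => mul_le_mul_of_nonneg_right (hinner x hx) (hf.nonneg_of_mem hx)
  refine le_trans (le_of_eq ?_) hmono
  have : ∫ x in (0:ℝ)..1, (x ^ 2 - 2 * m * x + q) * f x
      = ∫ x in (0:ℝ)..1, (x ^ 2 * f x - 2 * m * (x * f x) + q * f x) :=
    integral_congr fun x _ => by ring
  rw [this, intervalIntegral.integral_add (h2.sub (h1.const_mul _)) (h0.const_mul _),
    intervalIntegral.integral_sub h2 (h1.const_mul _),
    intervalIntegral.integral_const_mul, intervalIntegral.integral_const_mul, hf1, ← hm, ← hq]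
  ring

theorem neg_one_lt_kendallT (hf : IsGenerator f) : -1 < kendallT f := by
  rw [hf.kendallT_eq_moments]
  linarith [hf.integral_mul_one_sub_pos, hf.variance_le_integral_abs_sub]

end IsGenerator

/-- The uniform density on `[w/2, 3w/2]`. -/
noncomputable def uniformDensity (w x : ℝ) : ℝ :=
  if x ∈ Set.Icc (w / 2) (3 * w / 2) then 1 / w else 0

section UniformDensity

variable {w : ℝ}

theorem integral_mul_uniformDensity (hw0 : 0 < w) (h : ℝ → ℝ) {x : ℝ} (hx : w / 2 ≤ x)
    (hx' : x ≤ 3 * w / 2) :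
    ∫ t in (0:ℝ)..x, h t * uniformDensity w t = (∫ t in (w / 2)..x, h t) / w := by
  have hind : (fun t => h t * uniformDensity w t)
      = (Set.Icc (w / 2) (3 * w / 2)).indicator fun t => h t * (1 / w) := by
    ext t
    simp [uniformDensity, Set.indicator_apply]
  have hset : Set.Ioc 0 x ∩ Set.Icc (w / 2) (3 * w / 2) = Set.Icc (w / 2) x := by
    ext t
    simp only [Set.mem_inter_iff, Set.mem_Ioc, Set.mem_Icc]
    constructor
    · rintro ⟨⟨_, h1⟩, h2, _⟩
      exact ⟨h2, h1⟩
    · rintro ⟨h1, h2⟩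
      exact ⟨⟨by linarith, h2⟩, h1, h2.trans hx'⟩
  rw [hind, integral_of_le (by linarith), setIntegral_indicator measurableSet_Icc, hset,
    MeasureTheory.integral_mul_const, integral_of_le hx, integral_Icc_eq_integral_Ioc]
  ring

theorem integral_one_mul_uniformDensity (hw0 : 0 < w) (hw : w ≤ 1 / 2) (h : ℝ → ℝ) :
    ∫ t in (0:ℝ)..1, h t * uniformDensity w t = (∫ t in (w / 2)..(3 * w / 2), h t) / w := by
  have hind : (fun t => h t * uniformDensity w t)
      = (Set.Icc (w / 2) (3 * w / 2)).indicator fun t => h t * (1 / w) := by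
    ext t
    simp [uniformDensity, Set.indicator_apply]
  have hset : Set.Ioc 0 1 ∩ Set.Icc (w / 2) (3 * w / 2) = Set.Icc (w / 2) (3 * w / 2) :=
    Set.inter_eq_right.2 fun t ht => ⟨by linarith [ht.1], by linarith [ht.2]⟩
  rw [hind, integral_of_le zero_le_one, setIntegral_indicator measurableSet_Icc, hset,
    MeasureTheory.integral_mul_const, integral_of_le (by linarith), integral_Icc_eq_integral_Ioc]
  ring

theorem isGenerator_uniformDensity (hw0 : 0 < w) (hw : w ≤ 1 / 2) :
    IsGenerator (uniformDensity w) := by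
  refine ⟨Measurable.ite measurableSet_Icc measurable_const measurable_const, fun x _ => ?_, ?_⟩
  · unfold uniformDensity
    split_ifs <;> positivity
  · have := integral_one_mul_uniformDensity hw0 hw fun _ => 1
    rw [integral_of_le zero_le_one, ← integral_Icc_eq_integral_Ioc] at this
    simp only [one_mul] at this
    rw [this]
    simp only [intervalIntegral.integral_const, smul_eq_mul]
    field_simp
    norm_num

theorem primitiveFun_uniformDensity (hw0 : 0 < w) {x : ℝ}
    (hx : x ∈ Set.Icc (w / 2) (3 * w / 2)) :
    primitiveFun (uniformDensity w) x = (x - w / 2) / w := by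
  have := integral_mul_uniformDensity hw0 (fun _ => 1) hx.1 hx.2
  simpa [primitiveFun] using this

theorem kendallT_uniformDensity (hw0 : 0 < w) (hw : w ≤ 1 / 2) :
    kendallT (uniformDensity w) = 14 / 3 * (w - w ^ 2) - 1 := by
  have hle : w / 2 ≤ 3 * w / 2 := by linarith
  have e1 : ∫ t in (w / 2)..(3 * w / 2), (t - primitiveFun (uniformDensity w) t / 2 - 1 / 4)
      = ∫ t in (w / 2)..(3 * w / 2), (1 - 1 / (2 * w)) * t := by
    refine integral_congr fun t ht => ?_
    rw [Set.uIcc_of_le hle] at ht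
    simp only [primitiveFun_uniformDensity hw0 ht]
    field_simp
    ring
  have e2 : ∫ t in (w / 2)..(3 * w / 2), (t - primitiveFun (uniformDensity w) t / 2 - 1 / 4) ^ 2
      = ∫ t in (w / 2)..(3 * w / 2), (1 - 1 / (2 * w)) ^ 2 * t ^ 2 := by
    refine integral_congr fun t ht => ?_
    rw [Set.uIcc_of_le hle] at ht
    simp only [primitiveFun_uniformDensity hw0 ht]
    field_simp
    ring
  rw [(isGenerator_uniformDensity hw0 hw).kendallT_eq, integral_one_mul_uniformDensity hw0 hw,
    integral_one_mul_uniformDensity hw0 hw, e1, e2, intervalIntegral.integral_const_mul,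
    intervalIntegral.integral_const_mul, integral_id, integral_pow]
  field_simp
  ring

end UniformDensity

namespace IsGenerator

variable {f : ℝ → ℝ}

theorem kendallT_le (hf : IsGenerator f) : kendallT f ≤ 1 / 6 := by
  linarith [hf.kendallT_le_sub,
    hf.integral_sq_mul_nonneg fun x => x - primitiveFun f x / 2 - 1 / 4]

theorem kendallT_eq_iff (hf : IsGenerator f) :
    kendallT f = 1 / 6 ↔ ∀ᵐ x ∂(volume.restrict (Set.Icc (0:ℝ) 1)),
      f x = if x ∈ Set.Icc (1/4 : ℝ) (3/4) then 2 else 0 := by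
  constructor
  · intro h
    refine hf.ae_eq_of_primitiveFun_eq (hf.primitiveFun_eq_clampCDF (le_antisymm ?_ ?_))
    · linarith [hf.kendallT_le_sub]
    · exact hf.integral_sq_mul_nonneg fun x => x - primitiveFun f x / 2 - 1 / 4
  · intro h
    have hu : uniformDensity (1 / 2) = fun x => if x ∈ Set.Icc (1/4 : ℝ) (3/4) then 2 else 0 := by
      ext x
      simp only [uniformDensity]
      norm_num
    rw [hf.kendallT_congr_ae (isGenerator_uniformDensity (w := 1 / 2) (by norm_num) le_rfl)
      (by rw [hu]; exact h), kendallT_uniformDensity (by norm_num) le_rfl]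
    norm_num

end IsGenerator

theorem exists_isGenerator_kendallT_eq_iff {r : ℝ} :
    (∃ f, IsGenerator f ∧ kendallT f = r) ↔ r ∈ Set.Ioc (-1 : ℝ) (1 / 6) := by
  constructor
  · rintro ⟨f, hf, rfl⟩
    exact ⟨hf.neg_one_lt_kendallT, hf.kendallT_le⟩
  · rintro ⟨h1, h2⟩
    set s := √(1 - 6 / 7 * (r + 1)) with hs
    have hsq : s ^ 2 = 1 - 6 / 7 * (r + 1) := Real.sq_sqrt (by linarith)
    have hs0 : 0 ≤ s := Real.sqrt_nonneg _
    have hs1 : s < 1 := by nlinarith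
    refine ⟨uniformDensity ((1 - s) / 2),
      isGenerator_uniformDensity (by linarith) (by linarith), ?_⟩
    rw [kendallT_uniformDensity (by linarith) (by linarith)]
    linear_combination -7 / 6 * hsq

theorem stmt_11 :
    (∀ f : ℝ → ℝ, IsGenerator f →
      kendallT f ≤ 1 / 6 ∧
      (kendallT f = 1 / 6 ↔
        ∀ᵐ x ∂(volume.restrict (Set.Icc (0:ℝ) 1)),
          f x = if x ∈ Set.Icc (1/4 : ℝ) (3/4) then 2 else 0))
    ∧ ∀ s : Fin 2 → Bool,
      {r : ℝ | ∃ f : ℝ → ℝ, IsGenerator f ∧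
          r = (-1 : ℝ) ^ (((if s 0 then 1 else 0) + (if s 1 then 1 else 0) : ℕ)) * kendallT f}
        = if s 0 = s 1 then Set.Ioc (-1 : ℝ) (1/6) else Set.Ico (-(1/6) : ℝ) 1 := by
  refine ⟨fun f hf => ⟨hf.kendallT_le, hf.kendallT_eq_iff⟩, fun s => ?_⟩
  ext r
  by_cases hs : s 0 = s 1
  · rw [if_pos hs]
    have hsign : (-1 : ℝ) ^ ((if s 0 then 1 else 0) + (if s 1 then 1 else 0) : ℕ) = 1 := by
      rw [hs]
      cases s 1 <;> norm_num
    rw [← exists_isGenerator_kendallT_eq_iff]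
    simp only [Set.mem_ofPred_eq, hsign, one_mul, eq_comm (a := r)]
  · rw [if_neg hs]
    have hsign : (-1 : ℝ) ^ ((if s 0 then 1 else 0) + (if s 1 then 1 else 0) : ℕ) = -1 := by
      revert hs
      cases s 0 <;> cases s 1 <;> norm_num
    have hneg : r ∈ Set.Ico (-(1 / 6) : ℝ) 1 ↔ -r ∈ Set.Ioc (-1 : ℝ) (1 / 6) := by
      simp only [Set.mem_Ico, Set.mem_Ioc]
      constructor <;> rintro ⟨h1, h2⟩ <;> constructor <;> linarith
    rw [hneg, ← exists_isGenerator_kendallT_eq_iff]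
    simp only [Set.mem_ofPred_eq, hsign, neg_one_mul, eq_neg_iff_add_eq_zero, add_comm]
end
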